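/- arXiv:math/0504277 — 2 statements merged into one kernel-verified Lean document; each statement's English description precedes it below -/
import Mathlib

section
/- For all natural numbers m, n and variable x, there holds the finite bilateral series identity 1 = \sum_{k=-m}^{n} (1 - x q^k) \binom{m+n}{m+k}_q \frac{(-x;q)_{1+n} (-q/x;q)_{m}}{(x^2;q)_{1+n+k} (q/x^2;q)_{m-k}} x^{3k} q^{k^2 + \binom{k}{2}}, as an identity of rational functions in q and x. -/
/-- The q-shifted factorial `(a;q)_n = ∏_{j=0}^{n-1} (1 - a q^j)`. -/
noncomputable def qPoch {F : Type*} [Field F] (a q : F) (n : ℕ) : F :=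
  ∏ j ∈ Finset.range n, (1 - a * q ^ j)

/-- The q-shifted factorial with integer index. -/
noncomputable def qPochZ {F : Type*} [Field F] (a q : F) (n : ℤ) : F :=
  if 0 ≤ n then ∏ j ∈ Finset.range n.toNat, (1 - a * q ^ (j : ℤ))
  else (∏ j ∈ Finset.range (-n).toNat, (1 - a * q ^ (-(j : ℤ) - 1)))⁻¹

/-- The Gaussian binomial coefficient `(q;q)_m / ((q;q)_k (q;q)_{m-k})`. -/
noncomputable def qBinom {F : Type*} [Field F] (q : F) (m k : ℕ) : F :=
  qPoch q q m / (qPoch q q k * qPoch q q (m - k))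

/-! Auxiliary facts. -/

theorem aux_tri_succ (s : ℤ) : (s + 1) * (s + 1 + 1) / 2 = s * (s + 1) / 2 + (s + 1) := by
  have : (s + 1) * (s + 1 + 1) = s * (s + 1) + (s + 1) * 2 := by ring
  rw [this, Int.add_mul_ediv_right _ _ (by norm_num)]

theorem aux_tri (s : ℤ) : 2 * (s * (s + 1) / 2) = s * (s + 1) :=
  Int.mul_ediv_cancel' (Int.even_mul_succ_self s).two_dvd

theorem aux_tri' (s : ℤ) : 2 * (s * (s - 1) / 2) = s * (s - 1) :=
  Int.mul_ediv_cancel' (Int.even_mul_pred_self s).two_dvd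

theorem qPoch_zero' {F : Type*} [Field F] (a q : F) : qPoch a q 0 = 1 := by simp [qPoch]

theorem qPoch_succ' {F : Type*} [Field F] (a q : F) (n : ℕ) :
    qPoch a q (n + 1) = qPoch a q n * (1 - a * q ^ n) := by
  simp [qPoch, Finset.prod_range_succ]

theorem qPoch_succ_left {F : Type*} [Field F] (a q : F) (n : ℕ) :
    qPoch a q (n + 1) = (1 - a) * qPoch (a * q) q n := by
  simp only [qPoch, Finset.prod_range_succ', pow_zero, mul_one]
  rw [mul_comm]
  congr 1
  apply Finset.prod_congr rfl
  intro j _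
  ring

theorem qPoch_ne {F : Type*} [Field F] (a q : F) (n : ℕ)
    (h : ∀ j : ℕ, 1 - a * q ^ j ≠ 0) : qPoch a q n ≠ 0 :=
  Finset.prod_ne_zero_iff.2 fun j _ => h j

theorem qPoch_add {F : Type*} [Field F] (a q : F) (m n : ℕ) :
    qPoch a q (m + n) = qPoch a q m * qPoch (a * q ^ m) q n := by
  induction n with
  | zero => simp [qPoch_zero']
  | succ n ih =>
    rw [← add_assoc, qPoch_succ', qPoch_succ', ih]
    ring

/-- The summand of the unilateral identity. -/
noncomputable def qT {F : Type*} [Field F] (q y : F) (M k : ℕ) : F :=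
  (1 + y * q ^ k) * qBinom q M k * (qPoch y q (M + 1) / qPoch (q ^ k * y ^ 2) q (M + 1)) *
    y ^ k * q ^ (k ^ 2)

/-- The certificate, at `k + 1`. -/
noncomputable def qG {F : Type*} [Field F] (q y : F) (M k : ℕ) : F :=
  -(qBinom q M k * (qPoch y q (M + 1) / qPoch (q ^ (k + 1) * y ^ 2) q (M + 1)) *
    y ^ (k + 1) * q ^ ((k + 1) ^ 2 + (M - k)))

theorem aux_den {F : Type*} [Field F] (q y : F) (hy : ∀ j : ℕ, 1 - y ^ 2 * q ^ j ≠ 0)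
    (k : ℕ) : ∀ j : ℕ, 1 - q ^ k * y ^ 2 * q ^ j ≠ 0 := by
  intro j
  have := hy (k + j)
  rw [pow_add] at this
  intro h
  apply this
  rw [← h]
  ring

theorem qPoch_qq_ne {F : Type*} [Field F] (q : F) (hqq : ∀ j : ℕ, 1 - q ^ (j + 1) ≠ 0)
    (n : ℕ) : qPoch q q n ≠ 0 := by
  apply qPoch_ne
  intro j
  have := hqq j
  rwa [pow_succ'] at this

theorem aux_zero {F : Type*} [Field F] (q y : F) (M : ℕ)
    (hqq : ∀ j : ℕ, 1 - q ^ (j + 1) ≠ 0) (hy : ∀ j : ℕ, 1 - y ^ 2 * q ^ j ≠ 0) :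
    qT q y (M + 1) 0 - qT q y M 0 = qG q y M 0 := by
  have h1 := qPoch_qq_ne q hqq M
  have h2 := qPoch_qq_ne q hqq (M + 1)
  have e1 : qPoch (q ^ 0 * y ^ 2) q (M + 1 + 1) = (1 - y ^ 2) * qPoch (q * y ^ 2) q (M + 1) := by
    rw [qPoch_succ_left]; congr 2 <;> ring
  have e2 : qPoch (q ^ 0 * y ^ 2) q (M + 1) = (1 - y ^ 2) * qPoch (q * y ^ 2) q M := by
    rw [qPoch_succ_left]; congr 2 <;> ring
  have h3 : qPoch (q * y ^ 2) q M ≠ 0 :=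
    qPoch_ne _ _ _ (by simpa using aux_den q y hy 1)
  have h4 : 1 - q * y ^ 2 * q ^ M ≠ 0 := by simpa using aux_den q y hy 1 M
  have h5 : 1 - y ^ 2 ≠ 0 := by simpa using hy 0
  unfold qT qG qBinom
  rw [e1, e2, qPoch_succ' y q (M + 1)]
  simp only [zero_add, pow_one, Nat.sub_zero, qPoch_zero']
  rw [qPoch_succ' (q * y ^ 2) q M]
  generalize qPoch (q * y ^ 2) q M = R at *
  obtain ⟨D, hD⟩ : ∃ D, D = 1 - q * y ^ 2 * q ^ M := ⟨_, rfl⟩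
  obtain ⟨E, hE⟩ : ∃ E, E = 1 - y ^ 2 := ⟨_, rfl⟩
  rw [← hD] at h4 ⊢
  rw [← hE] at h5 ⊢
  field_simp
  rw [hD, hE]
  ring

theorem aux_step {F : Type*} [Field F] (q y : F) (k d : ℕ) (hq : q ≠ 0)
    (hqq : ∀ j : ℕ, 1 - q ^ (j + 1) ≠ 0) (hy : ∀ j : ℕ, 1 - y ^ 2 * q ^ j ≠ 0) :
    qT q y (k + 1 + d + 1) (k + 1) - qT q y (k + 1 + d) (k + 1)
      = qG q y (k + 1 + d) (k + 1) - qG q y (k + 1 + d) k := by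
  have p1 := qPoch_qq_ne q hqq k
  have p2 := qPoch_qq_ne q hqq d
  have p3 := hqq k
  have p4 := hqq d
  have a1 : k + 1 + d + 1 - (k + 1) = d + 1 := by omega
  have a2 : k + 1 + d - (k + 1) = d := by omega
  have a3 : k + 1 + d - k = d + 1 := by omega
  unfold qT qG qBinom
  rw [a1, a2, a3]
  have e1 : qPoch (q ^ (k + 1) * y ^ 2) q (k + 1 + d + 1) =
      (1 - q ^ (k + 1) * y ^ 2) * qPoch (q ^ (k + 1 + 1) * y ^ 2) q (k + 1 + d) := by
    rw [qPoch_succ_left]; congr 2; ring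
  have hR : qPoch (q ^ (k + 1 + 1) * y ^ 2) q (k + 1 + d) ≠ 0 :=
    qPoch_ne _ _ _ (aux_den q y hy _)
  have h4 := aux_den q y hy (k + 1 + 1) (k + 1 + d)
  have h5 : 1 - q ^ (k + 1) * y ^ 2 ≠ 0 := by simpa using aux_den q y hy (k + 1) 0
  have e2 : qPoch (q ^ (k + 1) * y ^ 2) q (k + 1 + d + 1 + 1) =
      (1 - q ^ (k + 1) * y ^ 2) * (qPoch (q ^ (k + 1 + 1) * y ^ 2) q (k + 1 + d) *
        (1 - q ^ (k + 1 + 1) * y ^ 2 * q ^ (k + 1 + d))) := by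
    rw [qPoch_succ_left, ← qPoch_succ']; congr 2; ring
  rw [e2, e1, qPoch_succ' (q ^ (k + 1 + 1) * y ^ 2) q (k + 1 + d),
    qPoch_succ' y q (k + 1 + d + 1), qPoch_succ' q q (k + 1 + d), qPoch_succ' q q k,
    qPoch_succ' q q d]
  have q1 : 1 - q * q ^ k ≠ 0 := by rwa [← pow_succ']
  have q2 : 1 - q * q ^ d ≠ 0 := by rwa [← pow_succ']
  generalize qPoch (q ^ (k + 1 + 1) * y ^ 2) q (k + 1 + d) = R at *
  generalize qPoch y q (k + 1 + d + 1) = Y at *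
  generalize qPoch q q (k + 1 + d) = Z at *
  generalize qPoch q q k = U at *
  generalize qPoch q q d = V at *
  have b1 : q ^ ((k + 1 + 1) ^ 2 + d) = q ^ ((k + 1) ^ 2) * (q ^ k) ^ 2 * q ^ 3 * q ^ d := by
    ring
  have b2 : q ^ ((k + 1) ^ 2 + (d + 1)) = q ^ ((k + 1) ^ 2) * q ^ d * q := by ring
  rw [b1, b2]
  generalize q ^ ((k + 1) ^ 2) = W at *
  simp only [pow_add, pow_one] at *
  generalize q ^ k = A at *
  generalize q ^ d = B at *
  generalize y ^ k = C at *
  have q3 : 1 - A * q ≠ 0 := by assumption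
  have q4 : 1 - B * q ≠ 0 := by assumption
  rw [mul_comm q A, mul_comm q B]
  obtain ⟨D, hD⟩ : ∃ D, D = 1 - A * q * q * y ^ 2 * (A * q * B) := ⟨_, rfl⟩
  obtain ⟨E, hE⟩ : ∃ E, E = 1 - A * q * y ^ 2 := ⟨_, rfl⟩
  obtain ⟨G, hG⟩ : ∃ G, G = 1 - A * q := ⟨_, rfl⟩
  obtain ⟨H, hH⟩ : ∃ H, H = 1 - B * q := ⟨_, rfl⟩
  rw [← hD] at h4 ⊢
  rw [← hE] at h5 ⊢
  rw [← hG] at q3 ⊢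
  rw [← hH] at q4 ⊢
  field_simp
  rw [hD, hE, hG, hH]
  ring

theorem aux_partial {F : Type*} [Field F] (q y : F) (M : ℕ) (hq : q ≠ 0)
    (hqq : ∀ j : ℕ, 1 - q ^ (j + 1) ≠ 0) (hy : ∀ j : ℕ, 1 - y ^ 2 * q ^ j ≠ 0) (K : ℕ)
    (hK : K ≤ M) :
    ∑ k ∈ Finset.range (K + 1), (qT q y (M + 1) k - qT q y M k) = qG q y M K := by
  induction K with
  | zero => simpa using aux_zero q y M hqq hy
  | succ K ih =>
    rw [Finset.sum_range_succ, ih (by omega)]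
    obtain ⟨d, rfl⟩ := Nat.exists_eq_add_of_le hK
    rw [aux_step q y K d hq hqq hy]
    ring

theorem aux_last {F : Type*} [Field F] (q y : F) (M : ℕ)
    (hqq : ∀ j : ℕ, 1 - q ^ (j + 1) ≠ 0) (hy : ∀ j : ℕ, 1 - y ^ 2 * q ^ j ≠ 0) :
    qG q y M M + qT q y (M + 1) (M + 1) = 0 := by
  have p1 := qPoch_qq_ne q hqq M
  have p2 := qPoch_qq_ne q hqq (M + 1)
  have hR : qPoch (q ^ (M + 1) * y ^ 2) q (M + 1) ≠ 0 := qPoch_ne _ _ _ (aux_den q y hy _)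
  have h4 := aux_den q y hy (M + 1) (M + 1)
  unfold qT qG qBinom
  rw [qPoch_succ' (q ^ (M + 1) * y ^ 2) q (M + 1), qPoch_succ' y q (M + 1)]
  simp only [Nat.sub_self, qPoch_zero', add_zero]
  generalize qPoch (q ^ (M + 1) * y ^ 2) q (M + 1) = R at *
  generalize q ^ ((M + 1) ^ 2) = W at *
  generalize q ^ (M + 1) = A at *
  obtain ⟨D, hD⟩ : ∃ D, D = 1 - A * y ^ 2 * A := ⟨_, rfl⟩
  rw [← hD] at h4 ⊢
  field_simp
  rw [hD]
  ring

theorem aux_unilateral {F : Type*} [Field F] (q y : F) (M : ℕ) (hq : q ≠ 0)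
    (hqq : ∀ j : ℕ, 1 - q ^ (j + 1) ≠ 0) (hy : ∀ j : ℕ, 1 - y ^ 2 * q ^ j ≠ 0) :
    ∑ k ∈ Finset.range (M + 1), qT q y M k = 1 := by
  induction M with
  | zero =>
    have h5 : 1 - y ^ 2 ≠ 0 := by simpa using hy 0
    simp [qT, qBinom, qPoch]
    field_simp
    ring
  | succ M ih =>
    have h1 := aux_partial q y M hq hqq hy M le_rfl
    have h2 := aux_last q y M hqq hy
    rw [Finset.sum_sub_distrib, ih] at h1
    rw [Finset.sum_range_succ]
    linear_combination h1 + h2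

theorem qPochZ_nat {F : Type*} [Field F] (a q : F) (n : ℕ) :
    qPochZ a q (n : ℤ) = qPoch a q n := by
  simp [qPochZ, qPoch]

theorem qPochZ_neg {F : Type*} [Field F] (a q : F) (n : ℕ) :
    qPochZ a q (-(n : ℤ)) = (∏ j ∈ Finset.range n, (1 - a * q ^ (-(j : ℤ) - 1)))⁻¹ := by
  rcases n with _ | n
  · simp [qPochZ]
  · unfold qPochZ
    rw [if_neg (by omega)]
    simp

theorem qPochZ_ne {F : Type*} [Field F] (a q : F) (ha : ∀ j : ℤ, 1 - a * q ^ j ≠ 0) (n : ℤ) :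
    qPochZ a q n ≠ 0 := by
  unfold qPochZ
  split_ifs
  · exact Finset.prod_ne_zero_iff.2 fun j _ => ha _
  · exact inv_ne_zero (Finset.prod_ne_zero_iff.2 fun j _ => ha _)

theorem qPochZ_succ {F : Type*} [Field F] (a q : F) (ha : ∀ j : ℤ, 1 - a * q ^ j ≠ 0) (n : ℤ) :
    qPochZ a q (n + 1) = qPochZ a q n * (1 - a * q ^ n) := by
  obtain ⟨k, rfl | rfl⟩ := n.eq_nat_or_neg
  · have : ((k : ℤ) + 1) = ((k + 1 : ℕ) : ℤ) := by push_cast; ring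
    rw [this, qPochZ_nat, qPochZ_nat, qPoch_succ', zpow_natCast]
  · rcases k with _ | k
    · simp [qPochZ]
    · have : (-((k + 1 : ℕ) : ℤ) + 1) = -(k : ℤ) := by push_cast; ring
      rw [this, qPochZ_neg, qPochZ_neg, Finset.prod_range_succ, mul_inv]
      have e : (-((k + 1 : ℕ) : ℤ)) = -(k : ℤ) - 1 := by push_cast; ring
      rw [e, inv_mul_cancel_right₀ (ha _)]

theorem aux_inv {F : Type*} [Field F] (a q : F) (hq : q ≠ 0) (ha0 : a ≠ 0)
    (ha : ∀ j : ℤ, 1 - a * q ^ j ≠ 0) : ∀ j : ℤ, 1 - q / a * q ^ j ≠ 0 := by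
  intro j h
  apply ha (-(j + 1))
  have h1 : q ^ (j + 1) = a := by
    rw [zpow_add_one₀ hq]
    field_simp at h
    linear_combination -h
  rw [zpow_neg, h1, mul_inv_cancel₀ ha0, sub_self]

theorem aux_refl {F : Type*} [Field F] (a q : F) (hq : q ≠ 0) (ha0 : a ≠ 0)
    (ha : ∀ j : ℤ, 1 - a * q ^ j ≠ 0) (s : ℤ) :
    qPochZ a q (-s) * qPochZ (q / a) q s * (-a) ^ s = q ^ (s * (s + 1) / 2) := by
  have key : ∀ s : ℤ, (qPochZ a q (-(s+1)) * qPochZ (q / a) q (s+1) * (-a) ^ (s+1)) =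
      qPochZ a q (-s) * qPochZ (q / a) q s * (-a) ^ s * q ^ (s + 1) := by
    intro s
    have h1 := qPochZ_succ a q ha (-(s+1))
    have e : -(s + 1) + 1 = -s := by ring
    rw [e] at h1
    rw [h1, qPochZ_succ (q / a) q (aux_inv a q hq ha0 ha), zpow_add_one₀ (neg_ne_zero.2 ha0),
      zpow_neg, zpow_add_one₀ hq]
    have := zpow_ne_zero s hq
    field_simp
    ring
  induction s using Int.induction_on with
  | zero => simp [qPochZ]
  | succ i ih => rw [key, ih, aux_tri_succ, ← zpow_add₀ hq]
  | pred i ih =>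
    have k1 := key (-(i : ℤ) - 1)
    have k2 := aux_tri_succ (-(i : ℤ) - 1)
    rw [sub_add_cancel] at k1 k2
    rw [ih, k2, zpow_add₀ hq] at k1
    rw [sub_add_cancel]
    exact (mul_right_cancel₀ (zpow_ne_zero _ hq) k1).symm

theorem aux_shift {F : Type*} [Field F] (a q : F) (hq : q ≠ 0) (ha0 : a ≠ 0)
    (ha : ∀ j : ℤ, 1 - a * q ^ j ≠ 0) (s : ℤ) (L : ℕ) :
    qPoch (a * q ^ (-s)) q L * q ^ (s * (s + 1) / 2) =
      qPochZ a q (L - s) * qPochZ (q / a) q s * (-a) ^ s := by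
  induction L with
  | zero => simp [qPoch_zero', aux_refl a q hq ha0 ha s]
  | succ L ih =>
    have e : ((L + 1 : ℕ) : ℤ) - s = (L - s) + 1 := by push_cast; ring
    have e2 : q ^ ((L : ℤ) - s) = q ^ (-s) * q ^ L := by
      rw [sub_eq_add_neg, zpow_add₀ hq, zpow_natCast, mul_comm]
    rw [e, qPochZ_succ a q ha, qPoch_succ', e2]
    linear_combination (1 - a * q ^ (-s) * q ^ L) * ih

theorem aux_num {F : Type*} [Field F] (x q : F) (hq : q ≠ 0) (hx : x ≠ 0) (m : ℕ) :
    qPoch (-x * q ^ (-(m : ℤ))) q m * q ^ ((m : ℤ) * (m + 1) / 2) =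
      x ^ m * qPoch (-(q / x)) q m := by
  induction m with
  | zero => simp [qPoch_zero']
  | succ m ih =>
    have e : -x * q ^ (-((m + 1 : ℕ) : ℤ)) * q = -x * q ^ (-(m : ℤ)) := by
      rw [mul_assoc, ← zpow_add_one₀ hq]; congr 2; push_cast; ring
    have e3 : q ^ (-((m + 1 : ℕ) : ℤ)) = (q ^ m)⁻¹ * q⁻¹ := by
      rw [zpow_neg, zpow_natCast, pow_succ, mul_inv]
    have e4 : q ^ ((m : ℤ) + 1) = q ^ m * q := by
      rw [zpow_add_one₀ hq, zpow_natCast]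
    rw [qPoch_succ_left, e, qPoch_succ', e3]
    push_cast
    rw [aux_tri_succ, zpow_add₀ hq, e4]
    have h := pow_ne_zero m hq
    have : (1 - -x * ((q ^ m)⁻¹ * q⁻¹)) * (q ^ m * q) = x * (1 - -(q / x) * q ^ m) := by
      field_simp
      ring
    linear_combination x * (1 - -(q / x) * q ^ m) * ih +
      qPoch (-x * q ^ (-(m : ℤ))) q m * q ^ ((m : ℤ) * (m + 1) / 2) * this

theorem aux_term {F : Type*} [Field F] (q x : F) (m n i : ℕ) (hq : q ≠ 0) (hx : x ≠ 0)
    (hden : ∀ j : ℤ, 1 - x ^ 2 * q ^ j ≠ 0) (k : ℤ) (hk : (m : ℤ) + k = i) :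
    (1 - x * q ^ k) * qBinom q (m + n) ((m : ℤ) + k).toNat *
        (qPoch (-x) q (1 + n) * qPoch (-(q / x)) q m /
          (qPochZ (x ^ 2) q (1 + (n : ℤ) + k) * qPochZ (q / x ^ 2) q ((m : ℤ) - k))) *
        x ^ (3 * k) * q ^ (k ^ 2 + k * (k - 1) / 2) =
      qT q (-x * q ^ (-(m : ℤ))) (m + n) i := by
  have hx2 : x ^ 2 ≠ 0 := pow_ne_zero 2 hx
  have hd := aux_shift (x ^ 2) q hq hx2 hden (m - k) (m + n + 1)
  have hn := aux_num x q hq hx m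
  have e1 : ((m + n + 1 : ℕ) : ℤ) - (m - k) = 1 + n + k := by push_cast; ring
  rw [e1] at hd
  have z1 := qPochZ_ne (x ^ 2) q hden (1 + n + k)
  have z2 := qPochZ_ne (q / x ^ 2) q (aux_inv (x ^ 2) q hq hx2 hden) (m - k)
  have e2 : q ^ i * (-x * q ^ (-(m : ℤ))) ^ 2 = x ^ 2 * q ^ (-((m : ℤ) - k)) := by
    have : q ^ (-((m : ℤ) - k)) = q ^ i * (q ^ (-(m : ℤ))) ^ 2 := by
      rw [← zpow_natCast q i, ← zpow_natCast (q ^ (-(m : ℤ))) 2, ← zpow_mul, ← zpow_add₀ hq]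
      congr 1; push_cast; linarith
    rw [this]; ring
  have e3 : qPoch (-x * q ^ (-(m : ℤ))) q (m + n + 1) =
      qPoch (-x * q ^ (-(m : ℤ))) q m * qPoch (-x) q (1 + n) := by
    rw [add_assoc, qPoch_add, add_comm n 1]
    congr 2
    rw [zpow_neg, zpow_natCast, inv_mul_cancel_right₀ (pow_ne_zero m hq)]
  have e4 : (1 + -x * q ^ (-(m : ℤ)) * q ^ i) = 1 - x * q ^ k := by
    have : q ^ k = q ^ (-(m : ℤ)) * q ^ i := by
      rw [← zpow_natCast q i, ← zpow_add₀ hq]; congr 1; linarith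
    rw [this]; ring
  have e5 : ((m : ℤ) + k).toNat = i := by omega
  unfold qT
  rw [e2, e3, e4, e5]
  have t1 := zpow_ne_zero (((m : ℤ) - k) * (m - k + 1) / 2) hq
  have t2 := zpow_ne_zero ((m : ℤ) * (m + 1) / 2) hq
  have t3 := zpow_ne_zero ((m : ℤ) - k) (neg_ne_zero.2 hx2)
  rw [← eq_div_iff t1] at hd
  rw [← eq_div_iff t2] at hn
  rw [hd, hn]
  have main : x ^ (3 * k) * q ^ (k ^ 2 + k * (k - 1) / 2) *
      (q ^ ((m : ℤ) * (m + 1) / 2) * (-x ^ 2) ^ ((m : ℤ) - k)) =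
      x ^ m * q ^ (((m : ℤ) - k) * (m - k + 1) / 2) *
        (-x * q ^ (-(m : ℤ))) ^ i * q ^ (i ^ 2) := by
    have f1 : (-x ^ 2) ^ ((m : ℤ) - k) = (-1) ^ ((m : ℤ) - k) * x ^ (2 * ((m : ℤ) - k)) := by
      rw [neg_eq_neg_one_mul, mul_zpow, ← zpow_natCast x 2, ← zpow_mul]; rfl
    have f2 : (-x * q ^ (-(m : ℤ))) ^ i = (-1) ^ i * x ^ (i : ℤ) * q ^ (-(m : ℤ) * i) := by
      rw [neg_eq_neg_one_mul, mul_pow, mul_pow, zpow_mul, zpow_natCast, zpow_natCast]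
    have f3 : (-1 : F) ^ ((m : ℤ) - k) = (-1) ^ i := by
      have : (m : ℤ) - k = i + 2 * (-k) := by linarith
      rw [this, zpow_add₀ (by simp), zpow_mul, zpow_natCast]
      norm_num
    have f4 : x ^ (3 * k) * x ^ (2 * ((m : ℤ) - k)) = x ^ m * x ^ (i : ℤ) := by
      rw [← zpow_natCast x m, ← zpow_add₀ hx, ← zpow_add₀ hx]
      congr 1; linarith
    have f5 : q ^ (k ^ 2 + k * (k - 1) / 2) * q ^ ((m : ℤ) * (m + 1) / 2) =
        q ^ (((m : ℤ) - k) * (m - k + 1) / 2) * q ^ (-(m : ℤ) * i) * q ^ (i ^ 2) := by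
      rw [← zpow_natCast q (i ^ 2), ← zpow_add₀ hq, ← zpow_add₀ hq, ← zpow_add₀ hq]
      congr 1
      have g1 := aux_tri m
      have g2 := aux_tri (m - k)
      have g3 := aux_tri' k
      push_cast
      rw [← hk]
      have g4 : 2 * (k ^ 2 + k * (k - 1) / 2 + (m : ℤ) * (m + 1) / 2) =
        2 * (((m : ℤ) - k) * (m - k + 1) / 2 + -(m : ℤ) * (m + k) + (m + k) ^ 2) := by
        linear_combination g1 - g2 + g3
      linarith
    rw [f1, f2, f3]
    linear_combination (-1) ^ i * (x ^ (3 * k) * x ^ (2 * ((m : ℤ) - k))) * f5 +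
      (-1) ^ i * (q ^ (((m : ℤ) - k) * (m - k + 1) / 2) * q ^ (-(m : ℤ) * i) * q ^ (i ^ 2)) * f4
  generalize qPochZ (x ^ 2) q (1 + n + k) = Z1 at *
  generalize qPochZ (q / x ^ 2) q (m - k) = Z2 at *
  generalize q ^ (((m : ℤ) - k) * (m - k + 1) / 2) = T1 at *
  generalize q ^ ((m : ℤ) * (m + 1) / 2) = T2 at *
  generalize (-x ^ 2) ^ ((m : ℤ) - k) = T3 at *
  generalize (-x * q ^ (-(m : ℤ))) ^ i = T4 at *
  generalize x ^ (3 * k) = T5 at *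
  generalize q ^ (k ^ 2 + k * (k - 1) / 2) = T6 at *
  generalize q ^ (i ^ 2) = T7 at *
  generalize qPoch (-x) q (1 + n) = A at *
  generalize qPoch (-(q / x)) q m = B at *
  generalize qBinom q (m + n) i = C at *
  generalize 1 - x * q ^ k = D at *
  have : D * C * (A * B / (Z1 * Z2)) * T5 * T6 =
      D * C * (A * B / (Z1 * Z2)) * ((T5 * T6 * (T2 * T3)) / (T2 * T3)) := by
    field_simp
  rw [this, main]
  field_simp

/-- Finite bilateral form of the quintuple product identity. -/
theorem finite_bilateral_quintuple {F : Type*} [Field F] (q x : F) (m n : ℕ)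
    (hq : q ≠ 0) (hx : x ≠ 0)
    (hden : ∀ j : ℤ, 1 - x ^ 2 * q ^ j ≠ 0)
    (hqq : ∀ j : ℕ, 1 - q ^ (j + 1) ≠ 0) :
    1 = ∑ k ∈ Finset.Icc (-(m : ℤ)) (n : ℤ),
      (1 - x * q ^ k) * qBinom q (m + n) ((m : ℤ) + k).toNat *
        (qPoch (-x) q (1 + n) * qPoch (-(q / x)) q m /
          (qPochZ (x ^ 2) q (1 + (n : ℤ) + k) * qPochZ (q / x ^ 2) q ((m : ℤ) - k))) *
        x ^ (3 * k) * q ^ (k ^ 2 + k * (k - 1) / 2) := by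
  have hy : ∀ j : ℕ, 1 - (-x * q ^ (-(m : ℤ))) ^ 2 * q ^ j ≠ 0 := by
    intro j
    have h := hden (-(m : ℤ) * 2 + j)
    rw [zpow_add₀ hq, zpow_mul, zpow_natCast] at h
    intro h'
    apply h
    rw [← h', mul_pow, neg_sq, mul_assoc]
    norm_cast
  refine (aux_unilateral q (-x * q ^ (-(m : ℤ))) (m + n) hq hqq hy).symm.trans ?_
  refine Finset.sum_bij (fun i _ => (i : ℤ) - m) ?_ ?_ ?_ ?_
  · intro i hi
    simp only [Finset.mem_range, Finset.mem_Icc] at *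
    omega
  · intro i _ j _ h
    omega
  · intro k hk
    simp only [Finset.mem_Icc] at hk
    refine ⟨(m + k).toNat, ?_, ?_⟩
    · simp only [Finset.mem_range]
      omega
    · omega
  · intro i _
    exact (aux_term q x m n i hq hx hden _ (by ring)).symm
end

section
/- Quintuple product identity: for complex q with 0 < |q| < 1 and nonzero complex x, \sum_{k=-\infty}^{\infty} (1 - x q^k) q^{3\binom{k}{2}} (q x^3)^k = (q;q)_\infty (x;q)_\infty (q/x;q)_\infty (qx^2;q^2)_\infty (q/x^2;q^2)_\infty, where the bilateral series converges absolutely. -/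
/-- The infinite q-Pochhammer symbol `(a;q)_∞ = ∏_{j=0}^∞ (1 - a q^j)`. -/
noncomputable def qPochInf (a q : ℂ) : ℂ := ∏' j : ℕ, (1 - a * q ^ j)

/-- General theta term `(-1)^k q^{k(k-1)/2} x^k`. -/
noncomputable def thT (q x : ℂ) (k : ℤ) : ℂ := (-1) ^ k * q ^ (k * (k - 1) / 2) * x ^ k

lemma binom_succ (k : ℤ) : (k + 1) * (k + 1 - 1) / 2 = k * (k - 1) / 2 + k := by
  have : (k + 1) * (k + 1 - 1) = k * (k - 1) + k * 2 := by ring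
  rw [this, Int.add_mul_ediv_right _ _ (by norm_num)]

lemma thT_succ {q x : ℂ} (hq : q ≠ 0) (hx : x ≠ 0) (k : ℤ) :
    thT q x (k + 1) = -(q ^ k * x) * thT q x k := by
  unfold thT
  rw [binom_succ, zpow_add₀ hq, zpow_add₀ hx, zpow_add₀ (by norm_num)]
  simp; ring

lemma thT_ne {q x : ℂ} (hq : q ≠ 0) (hx : x ≠ 0) (k : ℤ) : thT q x k ≠ 0 := by
  unfold thT
  have : (-1 : ℂ) ≠ 0 := by norm_num
  positivity

lemma thT_summable {q x : ℂ} (hq : q ≠ 0) (hq1 : ‖q‖ < 1) (hx : x ≠ 0) :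
    Summable (thT q x) := by
  have hp : Filter.Tendsto (fun n : ℕ => ‖q‖ ^ n) Filter.atTop (nhds 0) :=
    tendsto_pow_atTop_nhds_zero_of_lt_one (norm_nonneg _) hq1
  apply Summable.of_nat_of_neg
  · refine summable_of_ratio_test_tendsto_lt_one (l := 0) (by norm_num)
      (Filter.Eventually.of_forall fun n => thT_ne hq hx n) ?_
    have : (fun n : ℕ => ‖thT q x ((n + 1 : ℕ) : ℤ)‖ / ‖thT q x n‖) = fun n => ‖q‖ ^ n * ‖x‖ := by
      funext n
      have h := norm_ne_zero_iff.mpr (thT_ne hq hx n)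
      push_cast
      rw [thT_succ hq hx]
      simp [h]
    rw [this]
    simpa using hp.mul_const ‖x‖
  · refine summable_of_ratio_test_tendsto_lt_one (l := 0) (by norm_num)
      (Filter.Eventually.of_forall fun n => thT_ne hq hx (-n)) ?_
    have : (fun n : ℕ => ‖thT q x (-((n + 1 : ℕ) : ℤ))‖ / ‖thT q x (-n)‖)
        = fun n => ‖q‖ ^ n * (‖q‖ * ‖x‖⁻¹) := by
      funext n
      have h := norm_ne_zero_iff.mpr (thT_ne hq hx (-((n + 1 : ℕ) : ℤ)))
      have h2 : (-(n : ℤ)) = -((n + 1 : ℕ) : ℤ) + 1 := by push_cast; ring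
      have hq' := norm_ne_zero_iff.mpr hq
      have hx' := norm_ne_zero_iff.mpr hx
      rw [h2, thT_succ hq hx]
      simp only [norm_mul, norm_neg, norm_inv, norm_pow, zpow_neg, zpow_natCast]
      field_simp
      rw [pow_succ]
    rw [this]
    simpa using hp.mul_const (‖q‖ * ‖x‖⁻¹)

/-- finite `(q;q)_n` -/
noncomputable def qf (q : ℂ) (n : ℕ) : ℂ := ∏ j ∈ Finset.range n, (1 - q ^ (j + 1))

noncomputable def uu (q : ℂ) (n : ℤ) : ℂ := if n < 0 then 0 else (qf q n.toNat)⁻¹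

lemma one_sub_ne {q : ℂ} (hq1 : ‖q‖ < 1) (j : ℕ) : 1 - q ^ (j + 1) ≠ 0 := by
  intro h
  have h1 : q ^ (j + 1) = 1 := (sub_eq_zero.mp h).symm
  have h2 : ‖q‖ ^ (j + 1) < 1 := pow_lt_one₀ (norm_nonneg _) hq1 (by omega)
  rw [← norm_pow, h1] at h2
  simp at h2

lemma qf_ne {q : ℂ} (hq1 : ‖q‖ < 1) (n : ℕ) : qf q n ≠ 0 :=
  Finset.prod_ne_zero_iff.mpr fun j _ => one_sub_ne hq1 j

lemma uu_rec {q : ℂ} (hq1 : ‖q‖ < 1) (n : ℤ) : uu q n = (1 - q ^ (n + 1)) * uu q (n + 1) := by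
  unfold uu
  rcases lt_trichotomy n (-1) with h | h | h
  · rw [if_pos (by omega), if_pos (by omega)]; simp
  · subst h; simp
  · obtain ⟨m, rfl⟩ := Int.eq_ofNat_of_zero_le (show 0 ≤ n by omega)
    rw [if_neg (by omega), if_neg (by omega)]
    have e1 : ((m : ℤ) + 1).toNat = m + 1 := by omega
    rw [e1, Int.toNat_natCast]
    have e2 : q ^ ((m : ℤ) + 1) = q ^ (m + 1) := by exact_mod_cast zpow_natCast q (m + 1)
    have e3 : qf q (m + 1) = qf q m * (1 - q ^ (m + 1)) := Finset.prod_range_succ _ _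
    rw [e2, e3]
    have := qf_ne hq1 m
    have := one_sub_ne hq1 m
    field_simp

lemma finite_jtp {q x : ℂ} (hq : q ≠ 0) (hq1 : ‖q‖ < 1) (hx : x ≠ 0) (N : ℕ) :
    HasSum (fun k : ℤ => qf q (2 * N) * uu q (N + k) * uu q (N - k) * thT q x k)
      (∏ j ∈ Finset.range N, ((1 - x * q ^ j) * (1 - q / x * q ^ j))) := by
  induction N with
  | zero =>
    have h := hasSum_single (f := fun k : ℤ => qf q (2 * 0) * uu q ((0 : ℕ) + k)
      * uu q ((0 : ℕ) - k) * thT q x k) 0 (by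
        intro k hk
        rcases lt_or_gt_of_ne hk with h | h
        · simp [uu, h]
        · simp [uu, h])
    simpa [uu, qf, thT] using h
  | succ N ih =>
    have h1 := ih.mul_left (1 + q ^ (2 * N + 1))
    have h2 := ((Equiv.subRight (1 : ℤ)).hasSum_iff.mpr ih).mul_left (q ^ N * x)
    have h3 := ((Equiv.addRight (1 : ℤ)).hasSum_iff.mpr ih).mul_left (q ^ (N + 1) / x)
    have h := (h1.sub h2).sub h3
    rw [Finset.prod_range_succ]
    convert h using 1
    · rfl
    · funext k
      simp only [Function.comp, Equiv.subRight_apply, Equiv.coe_addRight]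
      have t1 : thT q x (k + 1) = -(q ^ k * x) * thT q x k := thT_succ hq hx k
      have t2 : thT q x k = -(q ^ (k - 1) * x) * thT q x (k - 1) := by
        have := thT_succ hq hx (k - 1)
        rwa [sub_add_cancel] at this
      have a1 := uu_rec hq1 (N + k)
      have a2 := uu_rec hq1 (N + (k - 1))
      have b1 := uu_rec hq1 (N - k)
      have b2 := uu_rec hq1 (N - (k + 1))
      have f1 : qf q (2 * (N + 1)) = qf q (2 * N) * (1 - q ^ (2 * N + 1)) * (1 - q ^ (2 * N + 2)) := by
        unfold qf
        rw [show 2 * (N + 1) = 2 * N + 1 + 1 by ring, Finset.prod_range_succ, Finset.prod_range_succ]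
      have c1 : (N : ℤ) + (k + 1) = N + k + 1 := by ring
      have c2 : (N : ℤ) + (k - 1) + 1 = N + k := by ring
      have c3 : (N : ℤ) - (k + 1) + 1 = N - k := by ring
      have c4 : (N : ℤ) - (k - 1) = N - k + 1 := by ring
      have c5 : ((N + 1 : ℕ) : ℤ) + k = N + k + 1 := by push_cast; ring
      have c6 : ((N + 1 : ℕ) : ℤ) - k = N - k + 1 := by push_cast; ring
      rw [c2] at a2
      rw [c3] at b2
      rw [c1, c4, c5, c6, a2, b2, a1, b1, t1, f1]
      rw [t2]
      set U := uu q (N + k + 1)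
      set V := uu q (N - k + 1)
      set t := thT q x (k - 1)
      set F := qf q (2 * N)
      have hk : q ^ k ≠ 0 := zpow_ne_zero _ hq
      simp only [zpow_add₀ hq, zpow_sub₀ hq, zpow_natCast, zpow_one, pow_succ, pow_mul]
      have hN : q ^ N ≠ 0 := pow_ne_zero _ hq
      rw [show (q ^ 0 * q * q) ^ N = q ^ N * q ^ N by rw [← mul_pow]; simp]
      set A := q ^ N
      set B := q ^ k
      field_simp
      ring
    · rw [pow_succ, pow_succ, two_mul, pow_add]
      field_simp
      ring

lemma poch_summable {q : ℂ} (hq1 : ‖q‖ < 1) (a : ℂ) : Summable fun j : ℕ => ‖-(a * q ^ j)‖ := by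
  simp only [norm_neg, norm_mul, norm_pow]
  exact (summable_geometric_of_lt_one (norm_nonneg _) hq1).mul_left _

lemma poch_tendsto {q : ℂ} (hq1 : ‖q‖ < 1) (a : ℂ) :
    Filter.Tendsto (fun N => ∏ j ∈ Finset.range N, (1 - a * q ^ j)) Filter.atTop
      (nhds (qPochInf a q)) := by
  have h := multipliable_one_add_of_summable (poch_summable hq1 a)
  simp only [← sub_eq_add_neg] at h
  exact h.tendsto_prod_tprod_nat

lemma poch_self_ne {q : ℂ} (hq1 : ‖q‖ < 1) : qPochInf q q ≠ 0 := by
  have h := tprod_one_add_ne_zero_of_summable (f := fun j : ℕ => -(q * q ^ j)) (by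
    intro j
    rw [← sub_eq_add_neg, ← pow_succ']
    exact one_sub_ne hq1 j) (poch_summable hq1 q)
  simp only [← sub_eq_add_neg] at h
  exact h

lemma qf_tendsto {q : ℂ} (hq1 : ‖q‖ < 1) :
    Filter.Tendsto (qf q) Filter.atTop (nhds (qPochInf q q)) := by
  have := poch_tendsto hq1 q
  simp only [← pow_succ'] at this
  exact this

lemma jtp {q x : ℂ} (hq : q ≠ 0) (hq1 : ‖q‖ < 1) (hx : x ≠ 0) :
    HasSum (thT q x) (qPochInf q q * qPochInf x q * qPochInf (q / x) q) := by
  have hne := poch_self_ne hq1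
  have hs := thT_summable hq hq1 hx
  have hqf := qf_tendsto hq1
  have hinv := hqf.inv₀ hne
  obtain ⟨C1, hC1⟩ := hqf.norm.bddAbove_range
  obtain ⟨C2, hC2⟩ := hinv.norm.bddAbove_range
  have hC1' : ∀ n, ‖qf q n‖ ≤ C1 := fun n => hC1 ⟨n, rfl⟩
  have hC2' : ∀ n, ‖(qf q n)⁻¹‖ ≤ C2 := fun n => hC2 ⟨n, rfl⟩
  have h1 : 0 ≤ C1 := (norm_nonneg _).trans (hC1' 0)
  have h2 : 0 ≤ C2 := (norm_nonneg _).trans (hC2' 0)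
  have hu : ∀ n, ‖uu q n‖ ≤ C2 := by
    intro n
    unfold uu
    split_ifs
    · simpa using h2
    · exact hC2' _
  have hut : Filter.Tendsto (uu q) Filter.atTop (nhds (qPochInf q q)⁻¹) := by
    have hn : Filter.Tendsto Int.toNat Filter.atTop Filter.atTop :=
      Filter.tendsto_atTop_atTop.mpr fun b => ⟨b, fun a ha => by omega⟩
    refine (hinv.comp hn).congr' ?_
    filter_upwards [Filter.eventually_ge_atTop 0] with n hn
    simp [uu, not_lt.mpr hn]
  have lim := tendsto_tsum_of_dominated_convergence
    (f := fun (N : ℕ) (k : ℤ) => qf q (2 * N) * uu q (N + k) * uu q (N - k) * thT q x k)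
    (g := fun k => qPochInf q q * (qPochInf q q)⁻¹ * (qPochInf q q)⁻¹ * thT q x k)
    (𝓕 := Filter.atTop)
    (bound := fun k => C1 * C2 * C2 * ‖thT q x k‖) (hs.norm.mul_left _) (by
      intro k
      refine (((hqf.comp ?_).mul (hut.comp ?_)).mul (hut.comp ?_)).mul_const _
      · exact Filter.tendsto_atTop_mono (fun n => by simp; omega) Filter.tendsto_id
      · exact Filter.tendsto_atTop_add_const_right _ _ tendsto_natCast_atTop_atTop
      · exact Filter.tendsto_atTop_add_const_right _ (-k) tendsto_natCast_atTop_atTop) (by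
      refine Filter.Eventually.of_forall fun N k => ?_
      simp only [norm_mul]
      gcongr
      · exact hC1' _
      · exact hu _
      · exact hu _)
  have lim2 := (poch_tendsto hq1 x).mul (poch_tendsto hq1 (q / x))
  simp only [← Finset.prod_mul_distrib] at lim2
  simp only [(finite_jtp hq hq1 hx _).tsum_eq] at lim
  have e := tendsto_nhds_unique lim lim2
  rw [tsum_mul_left, mul_inv_cancel₀ hne, one_mul] at e
  have e2 : ∑' k, thT q x k = qPochInf q q * qPochInf x q * qPochInf (q / x) q := by
    rw [mul_assoc, ← e, mul_inv_cancel_left₀ hne]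
  rw [← e2]
  exact hs.hasSum

lemma two_binom (k : ℤ) : 2 * (k * (k - 1) / 2) = k * (k - 1) :=
  Int.two_mul_ediv_two_of_even (by
    have := Int.even_mul_succ_self (k - 1)
    rwa [sub_add_cancel, mul_comm] at this)

lemma sgn_even (b c : ℤ) : (-1 : ℂ) ^ (b + 2 * c) = (-1) ^ b := by
  rw [zpow_add₀ (by norm_num), zpow_mul]
  simp

lemma sgn_odd (b c : ℤ) : (-1 : ℂ) ^ (b + 2 * c + 1) = -(-1) ^ b := by
  rw [zpow_add₀ (by norm_num), sgn_even]
  simp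

lemma poch_three {q : ℂ} (hq : q ≠ 0) (hq1 : ‖q‖ < 1) :
    qPochInf (q ^ 6) (q ^ 6) * qPochInf (q ^ 4) (q ^ 6) * qPochInf (q ^ 6 / q ^ 4) (q ^ 6)
      = qPochInf (q ^ 2) (q ^ 2) := by
  have h2 : ‖q ^ 2‖ < 1 := by rw [norm_pow]; exact pow_lt_one₀ (norm_nonneg _) hq1 (by norm_num)
  have h6 : ‖q ^ 6‖ < 1 := by rw [norm_pow]; exact pow_lt_one₀ (norm_nonneg _) hq1 (by norm_num)
  have l1 := ((poch_tendsto h6 (q ^ 6)).mul (poch_tendsto h6 (q ^ 4))).mul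
    (poch_tendsto h6 (q ^ 6 / q ^ 4))
  have l2 := (poch_tendsto h2 (q ^ 2)).comp
    (Filter.tendsto_atTop_mono (fun n : ℕ => (by simp; omega : id n ≤ 3 * n)) Filter.tendsto_id)
  refine tendsto_nhds_unique l1 (l2.congr fun N => ?_)
  simp only [Function.comp]
  have hd : q ^ 6 / q ^ 4 = q ^ 2 := by field_simp
  rw [hd]
  induction N with
  | zero => simp
  | succ N ih =>
    rw [show 3 * (N + 1) = 3 * N + 1 + 1 + 1 by ring]
    simp only [Finset.prod_range_succ, ih]
    ring

lemma pent {q : ℂ} (hq : q ≠ 0) (hq1 : ‖q‖ < 1) :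
    HasSum (fun m : ℤ => (-1 : ℂ) ^ m * q ^ (3 * m * m + m)) (qPochInf (q ^ 2) (q ^ 2)) := by
  have h6 : ‖q ^ 6‖ < 1 := by rw [norm_pow]; exact pow_lt_one₀ (norm_nonneg _) hq1 (by norm_num)
  have h := jtp (pow_ne_zero 6 hq) h6 (pow_ne_zero 4 hq)
  rw [poch_three hq hq1] at h
  refine h.congr_fun ?_
  intro m
  unfold thT
  rw [← zpow_natCast q 6, ← zpow_natCast q 4, ← zpow_mul, ← zpow_mul,
    mul_assoc ((-1 : ℂ) ^ m), ← zpow_add₀ hq]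
  congr 2
  have := two_binom m
  push_cast
  linear_combination (-3) * this

lemma term_eq {q x : ℂ} (hq : q ≠ 0) (hx : x ≠ 0) (i j : ℤ) :
    thT q x i * thT (q ^ 2) (q * x ^ 2) j
      = (-1) ^ (i + j) * q ^ (i * (i - 1) / 2 + j * j) * x ^ (i + 2 * j) := by
  unfold thT
  have e : i * (i - 1) / 2 + j * j = i * (i - 1) / 2 + 2 * (j * (j - 1) / 2) + j := by
    rw [two_binom]; ring_nf
  rw [e, ← zpow_natCast q 2, ← zpow_natCast x 2, mul_zpow, ← zpow_mul, ← zpow_mul,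
    zpow_add₀ (by norm_num), zpow_add₀ hx, zpow_add₀ hq, zpow_add₀ hq]
  push_cast
  ring

/-- The value of the inner sum divided by `(q^2;q^2)`. -/
noncomputable def HH (q x : ℂ) (k : ℤ) (r : Fin 3) : ℂ :=
  ![q ^ (3 * (k * (k - 1) / 2) + k) * x ^ (3 * k),
    -(x * q ^ k * (q ^ (3 * (k * (k - 1) / 2) + k) * x ^ (3 * k))), 0] r

lemma inner {q x : ℂ} (hq : q ≠ 0) (hq1 : ‖q‖ < 1) (hx : x ≠ 0)
    (hs : ∀ n : ℤ, Summable fun j : ℤ => thT q x (n - 2 * j) * thT (q ^ 2) (q * x ^ 2) j)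
    (k : ℤ) (r : Fin 3) :
    HasSum (fun j : ℤ => thT q x (k * 3 + (r : ℕ) - 2 * j) * thT (q ^ 2) (q * x ^ 2) j)
      (HH q x k r * qPochInf (q ^ 2) (q ^ 2)) := by
  have hp := (pent hq hq1).mul_left (HH q x k r)
  fin_cases r
  · rw [← (Equiv.addRight k).hasSum_iff]
    refine hp.congr_fun ?_
    intro m
    simp only [Function.comp, Equiv.coe_addRight, term_eq hq hx, HH]
    simp
    rw [show k * 3 - 2 * (m + k) + (m + k) = m + 2 * (k - m) by ring, sgn_even,
      show k * 3 = 3 * k by ring]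
    have e : (3 * k - 2 * (m + k)) * (3 * k - 2 * (m + k) - 1) / 2 + (m + k) * (m + k)
        = (3 * (k * (k - 1) / 2) + k) + (3 * m * m + m) := by
      apply mul_left_cancel₀ (two_ne_zero : (2 : ℤ) ≠ 0)
      linear_combination two_binom (3 * k - 2 * (m + k)) - 3 * two_binom k
    rw [e, zpow_add₀ hq (3 * (k * (k - 1) / 2) + k)]
    ring
  · rw [← (Equiv.subLeft k).hasSum_iff]
    refine hp.congr_fun ?_
    intro m
    simp only [Function.comp, Equiv.subLeft_apply, term_eq hq hx, HH]
    simp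
    rw [show k * 3 + 1 - 2 * (k - m) + (k - m) = m + 2 * k + 1 by ring, sgn_odd,
      show k * 3 = 3 * k by ring]
    have e : (3 * k + 1 - 2 * (k - m)) * (3 * k + 1 - 2 * (k - m) - 1) / 2 + (k - m) * (k - m)
        = k + (3 * (k * (k - 1) / 2) + k) + (3 * m * m + m) := by
      apply mul_left_cancel₀ (two_ne_zero : (2 : ℤ) ≠ 0)
      linear_combination two_binom (3 * k + 1 - 2 * (k - m)) - 3 * two_binom k
    rw [e, zpow_add₀ hq (k + (3 * (k * (k - 1) / 2) + k)), zpow_add₀ hq k, zpow_add₀ hx, zpow_one]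
    ring
  · have h := (hs (k * 3 + 2)).hasSum
    have h' := (Equiv.subLeft (2 * k + 1)).hasSum_iff.mpr h
    have hneg : ((fun j : ℤ => thT q x (k * 3 + 2 - 2 * j) * thT (q ^ 2) (q * x ^ 2) j) ∘
        (Equiv.subLeft (2 * k + 1)))
        = fun j : ℤ => -(thT q x (k * 3 + 2 - 2 * j) * thT (q ^ 2) (q * x ^ 2) j) := by
      funext j
      simp only [Function.comp, Equiv.subLeft_apply, term_eq hq hx]
      rw [show k * 3 + 2 - 2 * (2 * k + 1 - j) + (2 * k + 1 - j)
          = (k * 3 + 2 - 2 * j + j) + 2 * (j - k - 1) + 1 by ring, sgn_odd,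
        show k * 3 + 2 - 2 * (2 * k + 1 - j) + 2 * (2 * k + 1 - j)
          = k * 3 + 2 - 2 * j + 2 * j by ring]
      have e : (k * 3 + 2 - 2 * (2 * k + 1 - j)) * (k * 3 + 2 - 2 * (2 * k + 1 - j) - 1) / 2
          + (2 * k + 1 - j) * (2 * k + 1 - j)
          = (k * 3 + 2 - 2 * j) * (k * 3 + 2 - 2 * j - 1) / 2 + j * j := by
        apply mul_left_cancel₀ (two_ne_zero : (2 : ℤ) ≠ 0)
        linear_combination two_binom (k * 3 + 2 - 2 * (2 * k + 1 - j))
          - two_binom (k * 3 + 2 - 2 * j)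
      rw [e]
      ring
    rw [hneg] at h'
    have hz := h'.unique h.neg
    have hz2 := h'.neg
    simp only [neg_neg] at hz2
    have hz3 := h.unique hz2
    have h0 : ∑' j : ℤ, thT q x (k * 3 + 2 - 2 * j) * thT (q ^ 2) (q * x ^ 2) j = 0 :=
      self_eq_neg.mp hz3
    rw [h0] at h
    simpa [HH] using h

/-- Reindexing `(n, j) ↦ (n - 2 j, j)`. -/
def shear : ℤ × ℤ ≃ ℤ × ℤ where
  toFun p := (p.1 - 2 * p.2, p.2)
  invFun p := (p.1 + 2 * p.2, p.2)
  left_inv p := by simp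
  right_inv p := by simp

lemma quint {q x : ℂ} (hq : q ≠ 0) (hq1 : ‖q‖ < 1) (hx : x ≠ 0) :
    HasSum (fun k : ℤ => (1 - x * q ^ k) * q ^ (3 * (k * (k - 1) / 2) + k) * x ^ (3 * k))
      (qPochInf q q * qPochInf x q * qPochInf (q / x) q *
            qPochInf (q * x ^ 2) (q ^ 2) * qPochInf (q / x ^ 2) (q ^ 2)) := by
  have h2 : ‖q ^ 2‖ < 1 := by rw [norm_pow]; exact pow_lt_one₀ (norm_nonneg _) hq1 (by norm_num)
  have hq2 := pow_ne_zero 2 hq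
  have hx2 : q * x ^ 2 ≠ 0 := mul_ne_zero hq (pow_ne_zero 2 hx)
  have J1 := jtp hq hq1 hx
  have J2 := jtp hq2 h2 hx2
  have hd : q ^ 2 / (q * x ^ 2) = q / x ^ 2 := by field_simp
  rw [hd] at J2
  have hP := poch_self_ne h2
  have S := summable_mul_of_summable_norm J1.summable.norm J2.summable.norm
  have M := J1.mul J2 S
  have M1 := shear.hasSum_iff.mpr M
  have hs : ∀ n : ℤ, Summable fun j : ℤ => thT q x (n - 2 * j) * thT (q ^ 2) (q * x ^ 2) j :=
    fun n => M1.summable.prod_factor n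
  have M2 := (((Int.divModEquiv 3).symm.prodCongr (Equiv.refl ℤ)).hasSum_iff.mpr M1)
  have M3 := M2.prod_fiberwise (g := fun p => HH q x p.1 p.2 * qPochInf (q ^ 2) (q ^ 2)) (by
    rintro ⟨k, r⟩
    have := inner hq hq1 hx hs k r
    simpa [Function.comp, shear, Int.divModEquiv] using this)
  have M4 := (M3.prod_fiberwise (fun k => hasSum_fintype _)).div_const (qPochInf (q ^ 2) (q ^ 2))
  convert M4 using 1
  · rfl
  · funext k
    simp [Fin.sum_univ_three, HH]
    field_simp
    ring
  · field_simp

/-- The quintuple product identity: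
`∑_{k=-∞}^∞ (1 - x q^k) q^{3 binom(k,2)} (q x^3)^k
  = (q;q)_∞ (x;q)_∞ (q/x;q)_∞ (qx^2;q^2)_∞ (q/x^2;q^2)_∞`,
where the bilateral series converges absolutely. -/
theorem quintuple_product_identity (q x : ℂ) (hq0 : 0 < ‖q‖) (hq1 : ‖q‖ < 1)
    (hx : x ≠ 0) :
    (Summable fun k : ℤ => (1 - x * q ^ k) * q ^ (3 * (k * (k - 1) / 2) + k) * x ^ (3 * k))
    ∧ ∑' k : ℤ, (1 - x * q ^ k) * q ^ (3 * (k * (k - 1) / 2) + k) * x ^ (3 * k)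
        = qPochInf q q * qPochInf x q * qPochInf (q / x) q *
            qPochInf (q * x ^ 2) (q ^ 2) * qPochInf (q / x ^ 2) (q ^ 2) := by
  have h := quint (norm_pos_iff.mp hq0) hq1 hx
  exact ⟨h.summable, h.tsum_eq⟩
end
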